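/- Fix real numbers P ≥ 1 and Δ > 0. Then R⁻(P,Q,Δ,ρ*(P,Q)) tends to (1/2)·log₂(1+Δ) as Q → ∞. -/

import Mathlib

/-- Lower bound `R⁻` (in bits per symbol) on the secret-key capacity of the
Gaussian wiretap channel with state. -/
noncomputable def Rminus (P Q Δ ρ : ℝ) : ℝ :=
  (1 / 2) * Real.logb 2
    (1 + Δ * (P + Q + 2 * ρ * Real.sqrt (P * Q)) / (P + Q + 1 + Δ + 2 * ρ * Real.sqrt (P * Q)))

/-- The unique nonnegative solution `ρ*(P,Q)` of `P·(1−ρ²) = 1 − 1/(P+Q+1)`. -/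
noncomputable def rhoStar (P Q : ℝ) : ℝ :=
  Real.sqrt (1 - (1 - 1 / (P + Q + 1)) / P)

/-- `1 + Δ S / (S + 1 + Δ) → 1 + Δ` as `S → ∞`. -/
theorem tendsto_one_add_mul_div_atTop (Δ : ℝ) :
    Filter.Tendsto (fun S : ℝ => 1 + Δ * S / (S + 1 + Δ)) Filter.atTop (nhds (1 + Δ)) := by
  have hdiv : Filter.Tendsto (fun S : ℝ => Δ * (1 + Δ) / (S + (1 + Δ)))
      Filter.atTop (nhds 0) :=
    (Filter.tendsto_atTop_add_const_right _ _ Filter.tendsto_id).const_div_atTop _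
  have hlim := hdiv.const_sub (1 + Δ)
  rw [sub_zero] at hlim
  refine hlim.congr' ?_
  filter_upwards [Filter.eventually_gt_atTop (-(1 + Δ))] with S hS
  have h₁ : S + (1 + Δ) ≠ 0 := by linarith
  rw [add_assoc S 1 Δ]
  field_simp
  ring

/-- For nonnegative correlation, `R⁻` tends to `(1/2)·log₂(1+Δ)` as `Q → ∞`. -/
theorem Rminus_tendsto_of_nonneg (P Δ : ℝ) (hΔ : -1 < Δ) (ρ : ℝ → ℝ) (hρ : ∀ Q, 0 ≤ ρ Q) :
    Filter.Tendsto (fun Q : ℝ => Rminus P Q Δ (ρ Q))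
      Filter.atTop (nhds ((1 / 2) * Real.logb 2 (1 + Δ))) := by
  have hS : Filter.Tendsto (fun Q : ℝ => P + Q + 2 * ρ Q * Real.sqrt (P * Q))
      Filter.atTop Filter.atTop := by
    refine Filter.tendsto_atTop_mono (fun Q => ?_)
      (Filter.tendsto_atTop_add_const_left _ P Filter.tendsto_id)
    have := mul_nonneg (mul_nonneg zero_le_two (hρ Q)) (Real.sqrt_nonneg (P * Q))
    simpa using this
  have hpos : 1 + Δ ≠ 0 := by linarith
  have hlim := (((tendsto_one_add_mul_div_atTop Δ).comp hS).logb (b := 2) hpos).const_mul (1 / 2)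
  refine hlim.congr fun Q => ?_
  simp only [Rminus, Function.comp_apply]
  congr 4
  ring

/-- `R⁻(P,Q,Δ,ρ*(P,Q)) → (1/2)·log₂(1+Δ)` as `Q → ∞`. -/
theorem Rminus_tendsto_highINR (P Δ : ℝ) (hP : 1 ≤ P) (hΔ : 0 < Δ) :
    Filter.Tendsto (fun Q : ℝ => Rminus P Q Δ (rhoStar P Q))
      Filter.atTop (nhds ((1 / 2) * Real.logb 2 (1 + Δ))) :=
  Rminus_tendsto_of_nonneg P Δ (by linarith) _ fun _ => Real.sqrt_nonneg _
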